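/- Let F be a finite field with q elements, let s ≥ 1, ℓ ≥ 1 be integers and z_1, …, z_s ∈ ℕ, and set N = Σ_{i=1}^s (ℓ + z_i). For i = 1, …, s let T^{(i)} = [I_ℓ ; 0_{z_i × ℓ}] (the ℓ × ℓ identity on top of a z_i × ℓ zero block), and let Γ be the N × sℓ block-diagonal matrix whose i-th diagonal block is T^{(i)}. Let G be an arbitrary N × w matrix over F. Let X = ((M_1, K_1), (M_2, K_2), …, (M_s, K_s)) be a random row N-vector distributed uniformly on F^N, so that X·Γ = (M_1, M_2, …, M_s) ∈ (F^ℓ)^s. Then the random vectors X·G ∈ F^w and X·Γ = (M_1, …, M_s) are independent (with respect to the uniform probability measure on F^N) if and only if the column space of G and the column space of Γ intersect trivially, i.e. ⟨G⟩ ∩ ⟨Γ⟩ = {0}. -/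

import Mathlib

noncomputable section

/-- Every type is endowed with the `⊤` σ-algebra (every set measurable), the usual choice
for finite sample spaces. -/
local instance (priority := high) topMeasurableSpace (α : Type _) : MeasurableSpace α := ⊤

open ProbabilityTheory

/-- Two homomorphisms on a finite group carrying the uniform distribution are independent iff
their kernels generate the group. -/
theorem indepFun_uniform_iff_ker_sup_ker_eq_top {V A B : Type} [AddCommGroup V] [Fintype V]
    [AddCommGroup A] [AddCommGroup B] (f : V →+ A) (g : V →+ B) :
    IndepFun f g (PMF.uniformOfFintype V).toMeasure ↔ f.ker ⊔ g.ker = ⊤ := by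
  classical
  have hμ : ∀ s : Set V, (PMF.uniformOfFintype V).toMeasure s
      = (Nat.card s : ENNReal) / (Nat.card V : ENNReal) := fun s ↦ by
    rw [PMF.toMeasure_uniformOfFintype_apply s trivial, Nat.card_eq_fintype_card,
      Nat.card_eq_fintype_card]
  have hV : (Nat.card V : ENNReal) ≠ 0 := by simp
  have hV' : (Nat.card V : ENNReal) ≠ ⊤ := by simp
  rw [indepFun_iff_measure_inter_preimage_eq_mul]
  constructor
  · intro h
    refine (AddSubgroup.eq_top_iff' _).2 fun x ↦ ?_
    have hx := h {f x} {0} trivial trivial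
    have pos : ∀ (s : Set V), s.Nonempty → (PMF.uniformOfFintype V).toMeasure s ≠ 0 := by
      rintro s ⟨y, hy⟩
      have : Nonempty s := ⟨⟨y, hy⟩⟩
      rw [hμ]
      simp
    have hne : (f ⁻¹' {f x} ∩ g ⁻¹' {0}).Nonempty := by
      by_contra hempty
      rw [Set.not_nonempty_iff_eq_empty.1 hempty, MeasureTheory.measure_empty] at hx
      exact mul_ne_zero (pos (f ⁻¹' {f x}) ⟨x, rfl⟩) (pos (g ⁻¹' {0}) ⟨0, map_zero g⟩) hx.symm
    obtain ⟨y, hfy, hgy⟩ := hne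
    refine AddSubgroup.mem_sup.2 ⟨x - y, ?_, y, hgy, sub_add_cancel x y⟩
    rw [AddMonoidHom.mem_ker, map_sub, Set.mem_singleton_iff.1 hfy, sub_self]
  · intro h S T _ _
    have hdecomp : ∀ v : V, ∃ k : V, f k = 0 ∧ g k = g v := fun v ↦ by
      obtain ⟨k, hk, m, hm, rfl⟩ := AddSubgroup.mem_sup.1 (h ▸ AddSubgroup.mem_top v)
      exact ⟨k, hk, by rw [map_add, AddMonoidHom.mem_ker.1 hm, add_zero]⟩
    choose k hfk hgk using hdecomp
    let e : (f ⁻¹' S) × (g ⁻¹' T) ≃ ↑(f ⁻¹' S ∩ g ⁻¹' T) × V :=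
      { toFun p := (⟨p.1 - k (p.1 - p.2),
          by simpa only [Set.mem_preimage, map_sub, hfk, sub_zero] using p.1.2,
          by simpa only [Set.mem_preimage, map_sub, hgk, sub_sub_cancel] using p.2.2⟩, p.1 - p.2)
        invFun p := (⟨p.1 + k p.2, by simpa [hfk] using p.1.2.1⟩,
          ⟨p.1 + k p.2 - p.2, by simpa [hgk] using p.1.2.2⟩)
        left_inv p := by ext <;> simp
        right_inv p := by ext <;> simp }
    have hcard := Nat.card_congr e
    rw [Nat.card_prod, Nat.card_prod] at hcard
    have hcard' : (Nat.card (f ⁻¹' S) : ENNReal) * Nat.card (g ⁻¹' T)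
        = Nat.card ↑(f ⁻¹' S ∩ g ⁻¹' T) * Nat.card V := mod_cast hcard
    simp only [hμ, div_eq_mul_inv]
    rw [mul_mul_mul_comm, hcard', mul_mul_mul_comm, ENNReal.mul_inv_cancel hV hV', mul_one]

/-- A functional vanishing on the left kernel of a matrix is the dot product with a vector of its
column space. -/
theorem exists_dotProduct_mulVec_of_ker_vecMulLinear_le {F m n : Type*} [Field F] [Fintype m]
    [Fintype n] (A : Matrix m n F) (φ : (m → F) →ₗ[F] F)
    (h : LinearMap.ker A.vecMulLinear ≤ LinearMap.ker φ) :
    ∃ c : n → F, ∀ x, φ x = x ⬝ᵥ A.mulVec c := by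
  classical
  have hφ : φ ∈ LinearMap.range A.vecMulLinear.dualMap := by
    rw [LinearMap.range_dualMap_eq_dualAnnihilator_ker, Submodule.mem_dualAnnihilator]
    exact fun x hx ↦ h hx
  obtain ⟨ψ, rfl⟩ := hφ
  obtain ⟨c, rfl⟩ := (dotProductEquiv F n).surjective ψ
  refine ⟨c, fun x ↦ ?_⟩
  rw [Matrix.dotProduct_mulVec, dotProduct_comm]
  rfl

/-- The left kernels of two matrices span the whole space iff their column spaces intersect
trivially. -/
theorem ker_vecMulLinear_sup_eq_top_iff {F m n p : Type*} [Field F] [Fintype m] [Fintype n]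
    [Fintype p] (A : Matrix m n F) (B : Matrix m p F) :
    LinearMap.ker A.vecMulLinear ⊔ LinearMap.ker B.vecMulLinear = ⊤ ↔
      LinearMap.range A.mulVecLin ⊓ LinearMap.range B.mulVecLin = ⊥ := by
  classical
  constructor
  · refine fun h ↦ (Submodule.eq_bot_iff _).2 ?_
    rintro u ⟨⟨c, hc⟩, ⟨d, hd⟩⟩
    rw [Matrix.mulVecLin_apply] at hc hd
    refine dotProduct_eq_zero u fun x ↦ ?_
    obtain ⟨y, hy, t, ht, rfl⟩ := Submodule.mem_sup.1 (h ▸ Submodule.mem_top : x ∈ _)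
    rw [LinearMap.mem_ker, Matrix.vecMulLinear_apply] at hy ht
    have hyu : y ⬝ᵥ u = 0 := by rw [← hc, Matrix.dotProduct_mulVec, hy, zero_dotProduct]
    have htu : t ⬝ᵥ u = 0 := by rw [← hd, Matrix.dotProduct_mulVec, ht, zero_dotProduct]
    rw [dotProduct_comm, add_dotProduct, hyu, htu, add_zero]
  · intro h
    by_contra hne
    obtain ⟨φ, hφ, hle⟩ := Submodule.exists_le_ker_of_lt_top _ (lt_top_iff_ne_top.2 hne)
    obtain ⟨c, hc⟩ := exists_dotProduct_mulVec_of_ker_vecMulLinear_le A φ (le_sup_left.trans hle)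
    obtain ⟨d, hd⟩ := exists_dotProduct_mulVec_of_ker_vecMulLinear_le B φ (le_sup_right.trans hle)
    have hcd : A.mulVec c = B.mulVec d := dotProduct_eq _ _ fun x ↦ by
      rw [dotProduct_comm, ← hc, hd, dotProduct_comm]
    have hmem : A.mulVec c ∈ LinearMap.range A.mulVecLin ⊓ LinearMap.range B.mulVecLin :=
      ⟨⟨c, rfl⟩, ⟨d, hcd.symm⟩⟩
    rw [h, Submodule.mem_bot] at hmem
    exact hφ (LinearMap.ext fun x ↦ by rw [hc, hmem, dotProduct_zero, LinearMap.zero_apply])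

/-- Theorem 9: algebraic characterization of source security. Let `N = Σ_i (ℓ + z_i)` and
let `Γ` be the block-diagonal matrix with diagonal blocks `[I_ℓ ; 0_{z_i × ℓ}]`. For `X`
uniform on `F^N` (so that `X·Γ = (M_1, …, M_s)`), the random vectors `X·G` and `X·Γ` are
independent with respect to the uniform measure iff the column spaces of `G` and `Γ`
intersect trivially. -/
theorem indep_iff_trivial_inter_source
    {F : Type} [Field F] [Fintype F] [DecidableEq F]
    (q s l : ℕ) (hq : Fintype.card F = q) (hs : 1 ≤ s) (hl : 1 ≤ l)
    (z : Fin s → ℕ) (w : ℕ)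
    (Γ : Matrix ((i : Fin s) × Fin (l + z i)) (Fin s × Fin l) F)
    (hΓ : ∀ p c, Γ p c = if p.1 = c.1 ∧ (p.2 : ℕ) = ((c.2 : Fin l) : ℕ) then (1 : F) else 0)
    (G : Matrix ((i : Fin s) × Fin (l + z i)) (Fin w) F) :
    IndepFun (fun x : ((i : Fin s) × Fin (l + z i)) → F => Matrix.vecMul x G)
      (fun x : ((i : Fin s) × Fin (l + z i)) → F => Matrix.vecMul x Γ)
      (PMF.uniformOfFintype (((i : Fin s) × Fin (l + z i)) → F)).toMeasure ↔
    LinearMap.range G.mulVecLin ⊓ LinearMap.range Γ.mulVecLin = ⊥ := by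
  rw [← ker_vecMulLinear_sup_eq_top_iff, ← Submodule.toAddSubgroup_inj, Submodule.sup_toAddSubgroup]
  exact indepFun_uniform_iff_ker_sup_ker_eq_top G.vecMulLinear.toAddMonoidHom
    Γ.vecMulLinear.toAddMonoidHom

end
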